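/- There exist constants c > 0, ε > 0 and n₀ ∈ ℕ such that for every n ≥ n₀ and every SL_n(ℝ)-invariant Borel probability measure ν on SL_n(ℝ)/SL_n(ℤ), the measure of the set of cosets g·SL_n(ℤ) such that the lattice g·ℤⁿ contains a nonzero vector of norm at most c·√n is at most 2^{−εn}; equivalently, ν({g·SL_n(ℤ) : λ₁(g·ℤⁿ) ≤ c√n}) ≤ 2^{−εn}. -/

import Mathlib

open MeasureTheory Matrix

noncomputable section

/-- `SL n` is the special linear group `SL_n(ℝ)`. -/
abbrev SL (n : ℕ) : Type := Matrix.SpecialLinearGroup (Fin n) ℝ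

/-- The subgroup `SL_n(ℤ)` of `SL_n(ℝ)` (image of the integral special linear
group under the coefficient embedding `ℤ → ℝ`). -/
def SLZ (n : ℕ) : Subgroup (SL n) :=
  (Matrix.SpecialLinearGroup.map (n := Fin n) (Int.castRingHom ℝ)).range

instance (n : ℕ) : TopologicalSpace (SL n) :=
  TopologicalSpace.induced (fun g : SL n => (g : Matrix (Fin n) (Fin n) ℝ)) inferInstance

/-- The space of lattices `SL_n(ℝ)/SL_n(ℤ)` carries the Borel σ-algebra of its
quotient topology. -/
instance (n : ℕ) : MeasurableSpace (SL n ⧸ SLZ n) := borel _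

/-- The lattice `g·ℤⁿ ⊆ ℝⁿ` attached to `g ∈ SL_n(ℝ)`. -/
def latticeOf {n : ℕ} (g : SL n) : Set (EuclideanSpace ℝ (Fin n)) :=
  {x | ∃ v : Fin n → ℤ,
    x = (EuclideanSpace.equiv (Fin n) ℝ).symm
          ((g : Matrix (Fin n) (Fin n) ℝ).mulVec fun j => (v j : ℝ))}

open Filter Topology ENNReal

lemma volume_sum_sq_affine_lt_le {m : ℕ} (x : Fin m → ℝ) {s b : ℝ} (hs : s ≠ 0) (hb : 0 < b)
    (r : ℝ) :
    volume {u : Fin m → ℝ | ∑ i, (x i + u i * s) ^ 2 < r} ≤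
      ENNReal.ofReal (Real.exp (b * r) * √(Real.pi / (b * s ^ 2)) ^ m) := by
  have hbs : 0 < b * s ^ 2 := by positivity
  set f : Fin m → ℝ → ℝ := fun i t => Real.exp (-b * (x i + t * s) ^ 2) with hf
  have hf' : ∀ i, f i = fun t => Real.exp (-(b * s ^ 2) * (t + x i / s) ^ 2) := by
    intro i
    funext t
    simp only [hf]
    congr 1
    field_simp
    ring
  have hint : ∀ i, Integrable (f i) := by
    intro i
    rw [hf']
    exact (integrable_exp_neg_mul_sq hbs).comp_add_right (x i / s)
  have hval : ∀ i, ∫ t, f i t = √(Real.pi / (b * s ^ 2)) := by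
    intro i
    rw [hf', integral_add_right_eq_self (fun t => Real.exp (-(b * s ^ 2) * t ^ 2)),
      integral_gaussian]
  have hprod : Integrable (fun u : Fin m → ℝ => Real.exp (b * r) * ∏ i, f i (u i)) :=
    (Integrable.fintype_prod hint).const_mul _
  have hmeas : MeasurableSet {u : Fin m → ℝ | ∑ i, (x i + u i * s) ^ 2 < r} :=
    measurableSet_lt (by fun_prop) measurable_const
  calc volume {u : Fin m → ℝ | ∑ i, (x i + u i * s) ^ 2 < r}
      = ∫⁻ u, Set.indicator {u : Fin m → ℝ | ∑ i, (x i + u i * s) ^ 2 < r} 1 u := by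
        rw [lintegral_indicator_one hmeas]
    _ ≤ ∫⁻ u : Fin m → ℝ, ENNReal.ofReal (Real.exp (b * r) * ∏ i, f i (u i)) := by
        refine lintegral_mono fun u => ?_
        by_cases hu : u ∈ {u : Fin m → ℝ | ∑ i, (x i + u i * s) ^ 2 < r}
        swap
        · simp [Set.indicator_of_notMem hu]
        rw [Set.indicator_of_mem hu]
        simp only [Pi.one_apply, ENNReal.one_le_ofReal, hf, ← Real.exp_sum, ← Real.exp_add,
          ← Finset.mul_sum]
        rw [Real.one_le_exp_iff]
        have : ∑ i, (x i + u i * s) ^ 2 < r := hu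
        nlinarith
    _ = ENNReal.ofReal (∫ u : Fin m → ℝ, Real.exp (b * r) * ∏ i, f i (u i)) := by
        rw [ofReal_integral_eq_lintegral_ofReal hprod]
        exact Eventually.of_forall fun u => by simp only [hf]; positivity
    _ = _ := by
        rw [integral_const_mul, integral_fintype_prod_volume_eq_prod]
        simp [hval]

/-- The translates of the unit cube by integer vectors tile space. -/
lemma tsum_le_lintegral_floor {ι : Type*} [Fintype ι] (a : (ι → ℤ) → ℝ≥0∞)
    (F : (ι → ℝ) → ℝ≥0∞) (h : ∀ y, a (fun i => ⌊y i⌋) ≤ F y) :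
    ∑' v, a v ≤ ∫⁻ y, F y := by
  set C : (ι → ℤ) → Set (ι → ℝ) := fun v => {y | (fun i => ⌊y i⌋) = v} with hC
  have hCeq : ∀ v, C v = Set.univ.pi fun i => Set.Ico (v i : ℝ) (v i + 1) := by
    intro v
    ext y
    simp [hC, funext_iff, Int.floor_eq_iff]
  have hCm : ∀ v, MeasurableSet (C v) := by
    intro v
    rw [hCeq]
    exact MeasurableSet.univ_pi fun i => measurableSet_Ico
  have hCv : ∀ v, volume (C v) = 1 := by
    intro v
    rw [hCeq, Real.volume_pi_Ico]
    simp
  have hCd : Pairwise (Function.onFun Disjoint C) := by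
    intro v w hvw
    refine Set.disjoint_left.2 fun y hv hw => hvw ?_
    exact hv.symm.trans hw
  calc ∑' v, a v = ∑' v, ∫⁻ _ in C v, a v := by simp [hCv]
    _ ≤ ∑' v, ∫⁻ y in C v, F y := by
        refine ENNReal.tsum_le_tsum fun v => setLIntegral_mono' (hCm v) fun y hy => ?_
        have : (fun i => ⌊y i⌋) = v := hy
        exact this ▸ h y
    _ = ∫⁻ y in ⋃ v, C v, F y := (lintegral_iUnion hCm hCd F).symm
    _ ≤ ∫⁻ y, F y := setLIntegral_le_lintegral _ _

/-- A majorant of the volume of the unipotent parameters moving a vector near `w` into a ball: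
it decays in the leading coordinate and lives on a truncated cone. -/
def coneWeight (m : ℕ) (K M : ℝ) (w : Fin (m + 1) → ℝ) : ℝ≥0∞ :=
  Set.indicator {w : Fin (m + 1) → ℝ | |w 0| ≤ M ∧ ∀ i : Fin m, |w i.succ| ≤ 4 * |w 0|}
    (fun w => ENNReal.ofReal (K * (|w 0|⁻¹) ^ m)) w

lemma measurableSet_cone (m : ℕ) (M : ℝ) :
    MeasurableSet {w : Fin (m + 1) → ℝ | |w 0| ≤ M ∧ ∀ i : Fin m, |w i.succ| ≤ 4 * |w 0|} := by
  have h1 : IsClosed {w : Fin (m + 1) → ℝ | |w 0| ≤ M} := isClosed_le (by fun_prop) (by fun_prop)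
  have h2 : IsClosed {w : Fin (m + 1) → ℝ | ∀ i : Fin m, |w i.succ| ≤ 4 * |w 0|} := by
    simp only [Set.ofPred_forall]
    exact isClosed_iInter fun i => isClosed_le (by fun_prop) (by fun_prop)
  exact h1.measurableSet.inter h2.measurableSet

lemma measurable_coneWeight (m : ℕ) (K M : ℝ) : Measurable (coneWeight m K M) := by
  refine Measurable.indicator ?_ (measurableSet_cone m M)
  fun_prop

lemma lintegral_coneWeight_le (m : ℕ) {K : ℝ} (M : ℝ) (hK : 0 ≤ K) :
    ∫⁻ w, coneWeight m K M w ≤ ENNReal.ofReal (K * 8 ^ m * (2 * M)) := by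
  have hmp := volume_preserving_piFinSuccAbove (fun _ : Fin (m + 1) => ℝ) 0
  rw [← hmp.symm.lintegral_comp (measurable_coneWeight m K M)]
  rw [Measure.volume_eq_prod, lintegral_prod _ (by
    exact ((measurable_coneWeight m K M).comp (MeasurableEquiv.measurable _)).aemeasurable)]
  have key : ∀ s : ℝ, ∫⁻ w : Fin m → ℝ,
      coneWeight m K M ((MeasurableEquiv.piFinSuccAbove (fun _ : Fin (m + 1) => ℝ) 0).symm (s, w))
      ≤ Set.indicator (Set.Icc (-M) M) (fun _ => ENNReal.ofReal (K * 8 ^ m)) s := by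
    intro s
    have hcw : ∀ w : Fin m → ℝ,
        coneWeight m K M
          ((MeasurableEquiv.piFinSuccAbove (fun _ : Fin (m + 1) => ℝ) 0).symm (s, w)) =
        Set.indicator (Set.Icc (-M) M) (fun _ => Set.indicator
          (Set.Icc (fun _ => -(4 * |s|)) (fun _ => 4 * |s|))
          (fun _ => ENNReal.ofReal (K * (|s|⁻¹) ^ m)) w) s := by
      intro w
      simp only [coneWeight, Set.indicator, MeasurableEquiv.piFinSuccAbove,
        MeasurableEquiv.symm_mk, MeasurableEquiv.coe_mk, Fin.insertNthEquiv_zero,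
        Set.mem_ofPred_eq, Set.mem_Icc, Pi.le_def, ← abs_le]
      simp only [← forall_and, ← abs_le]
      simp [Fin.consEquiv, ite_and]
    simp only [hcw]
    by_cases hs : s ∈ Set.Icc (-M) M
    · simp only [Set.indicator_of_mem hs]
      rw [lintegral_indicator_const measurableSet_Icc, Real.volume_Icc_pi]
      simp only [Finset.prod_const, Finset.card_univ, Fintype.card_fin, sub_neg_eq_add]
      rw [← ENNReal.ofReal_pow (by positivity), ← ENNReal.ofReal_mul (by positivity)]
      refine ENNReal.ofReal_le_ofReal ?_
      rw [mul_assoc, ← mul_pow]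
      gcongr
      rcases eq_or_ne s 0 with rfl | h0
      · simp
      · have : |s| ≠ 0 := abs_ne_zero.2 h0
        field_simp
        norm_num
    · simp [Set.indicator_of_notMem hs]
  refine (lintegral_mono key).trans ?_
  rw [lintegral_indicator_const measurableSet_Icc, Real.volume_Icc,
    ← ENNReal.ofReal_mul (by positivity)]
  exact ENNReal.ofReal_le_ofReal (by linarith)

/-- The unimodular matrix `(x₀, x') ↦ (T⁻ᵐ x₀, T (x' + x₀ u))`. -/
def shear (m : ℕ) (T : ℝ) (u : Fin m → ℝ) : Matrix (Fin (m + 1)) (Fin (m + 1)) ℝ :=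
  Matrix.of (Fin.cons (Fin.cons (T ^ m)⁻¹ fun _ => 0)
    fun i => Fin.cons (T * u i) fun j => if i = j then T else 0)

lemma shear_mulVec_zero (m : ℕ) (T : ℝ) (u : Fin m → ℝ) (x : Fin (m + 1) → ℝ) :
    (shear m T u *ᵥ x) 0 = (T ^ m)⁻¹ * x 0 := by
  simp [shear, Matrix.mulVec, dotProduct, Fin.sum_univ_succ]

lemma shear_mulVec_succ (m : ℕ) (T : ℝ) (u : Fin m → ℝ) (x : Fin (m + 1) → ℝ) (i : Fin m) :
    (shear m T u *ᵥ x) i.succ = T * (x i.succ + u i * x 0) := by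
  simp [shear, Matrix.mulVec, dotProduct, Fin.sum_univ_succ]
  ring

lemma det_shear (m : ℕ) {T : ℝ} (hT : T ≠ 0) (u : Fin m → ℝ) : (shear m T u).det = 1 := by
  rw [Matrix.det_of_isLowerTriangular]
  · simp [shear, Fin.prod_univ_succ, hT]
  · intro i j hij
    have hij : i < j := hij
    induction j using Fin.cases with
    | zero => exact absurd hij (Fin.not_lt_zero i)
    | succ j =>
      induction i using Fin.cases with
      | zero => simp [shear]
      | succ i =>
        have : i ≠ j := (Fin.succ_lt_succ_iff.1 hij).ne
        simp [shear, this]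

/-- The parameters `u` in the unit cube for which `shear m T u` moves `x` into the open ball of
squared radius `r`. -/
def hitSet (m : ℕ) (T r : ℝ) (x : Fin (m + 1) → ℝ) : Set (Fin m → ℝ) :=
  {u | u ∈ Set.Icc 0 1 ∧ ∑ j, (shear m T u *ᵥ x) j ^ 2 < r}

lemma sum_shear_mulVec_sq (m : ℕ) (T : ℝ) (u : Fin m → ℝ) (x : Fin (m + 1) → ℝ) :
    ∑ j, (shear m T u *ᵥ x) j ^ 2 =
      ((T ^ m)⁻¹ * x 0) ^ 2 + T ^ 2 * ∑ i : Fin m, (x i.succ + u i * x 0) ^ 2 := by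
  simp only [Fin.sum_univ_succ, shear_mulVec_zero, shear_mulVec_succ, Finset.mul_sum, mul_pow]

lemma sum_sq_lt_of_mem_hitSet {m : ℕ} {T r : ℝ} (hT : 0 < T) {x : Fin (m + 1) → ℝ}
    {u : Fin m → ℝ} (hu : u ∈ hitSet m T r x) :
    ∑ i : Fin m, (x i.succ + u i * x 0) ^ 2 < r / T ^ 2 := by
  have h := hu.2
  rw [sum_shear_mulVec_sq] at h
  rw [lt_div_iff₀ (by positivity)]
  nlinarith [sq_nonneg ((T ^ m)⁻¹ * x 0)]

lemma abs_zero_le_of_mem_hitSet {m : ℕ} {T r : ℝ} (hT : 0 < T) {x : Fin (m + 1) → ℝ}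
    {u : Fin m → ℝ} (hu : u ∈ hitSet m T r x) : |x 0| ≤ √r * T ^ m := by
  have h := hu.2
  rw [sum_shear_mulVec_sq] at h
  have h0 : 0 ≤ T ^ 2 * ∑ i : Fin m, (x i.succ + u i * x 0) ^ 2 := by positivity
  have h1 : |(T ^ m)⁻¹ * x 0| ≤ √r := Real.abs_le_sqrt (by linarith)
  rw [abs_mul, abs_of_pos (by positivity), inv_mul_le_iff₀ (by positivity)] at h1
  linarith

lemma abs_succ_le_of_mem_hitSet {m : ℕ} {T r : ℝ} (hT : 1 ≤ T) {x : Fin (m + 1) → ℝ}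
    {u : Fin m → ℝ} (hu : u ∈ hitSet m T r x) (i : Fin m) : |x i.succ| ≤ |x 0| + √r := by
  have h := sum_sq_lt_of_mem_hitSet (by linarith) hu
  have hr : 0 ≤ r := (Finset.sum_nonneg fun j _ => sq_nonneg _).trans hu.2.le
  have h1 : (x i.succ + u i * x 0) ^ 2 ≤ r := by
    refine (Finset.single_le_sum (f := fun i : Fin m => (x i.succ + u i * x 0) ^ 2)
      (fun j _ => sq_nonneg _) (Finset.mem_univ i)).trans (h.le.trans ?_)
    exact div_le_self hr (one_le_pow₀ hT)
  have h2 := Real.abs_le_sqrt h1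
  have h3 : |u i * x 0| ≤ |x 0| := by
    rw [abs_mul]
    refine mul_le_of_le_one_left (abs_nonneg _) ?_
    rw [abs_of_nonneg (hu.1.1 i)]
    exact hu.1.2 i
  calc |x i.succ| = |(x i.succ + u i * x 0) - u i * x 0| := by ring_nf
    _ ≤ _ := abs_sub _ _
    _ ≤ _ := by linarith

lemma volume_hitSet_le {m : ℕ} {T a N : ℝ} (hT : 0 < T) (ha : 0 < a)
    {x : Fin (m + 1) → ℝ} (hx : x 0 ≠ 0) :
    volume (hitSet m T (a ^ 2 * N) x) ≤
      ENNReal.ofReal (Real.exp N * (√Real.pi * a / T * |x 0|⁻¹) ^ m) := by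
  have h := volume_sum_sq_affine_lt_le (fun i : Fin m => x i.succ) hx
    (b := T ^ 2 / a ^ 2) (by positivity) (a ^ 2 * N / T ^ 2)
  have e1 : T ^ 2 / a ^ 2 * (a ^ 2 * N / T ^ 2) = N := by field_simp
  have e2 : √(Real.pi / (T ^ 2 / a ^ 2 * x 0 ^ 2)) = √Real.pi * a / T * |x 0|⁻¹ := by
    have : T ^ 2 / a ^ 2 * x 0 ^ 2 = (T / a * |x 0|) ^ 2 := by rw [mul_pow, div_pow, sq_abs]
    rw [this, Real.sqrt_div Real.pi_pos.le, Real.sqrt_sq (by positivity)]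
    have := abs_ne_zero.2 hx
    field_simp
  rw [e1, e2] at h
  exact (measure_mono fun u hu => sum_sq_lt_of_mem_hitSet hT hu).trans h

lemma tendsto_volume_hitSet {m : ℕ} (hm : m ≠ 0) {a N : ℝ} (ha : 0 < a)
    {x : Fin (m + 1) → ℝ} (hx : x ≠ 0) :
    Tendsto (fun k : ℕ => volume (hitSet m ((k : ℝ) + 1) (a ^ 2 * N) x)) atTop (𝓝 0) := by
  have hlim : Tendsto (fun k : ℕ => (k : ℝ) + 1) atTop atTop :=
    tendsto_atTop_add_const_right _ _ tendsto_natCast_atTop_atTop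
  by_cases h0 : x 0 = 0
  · have hpos : 0 < ∑ i : Fin m, x i.succ ^ 2 := by
      refine lt_of_le_of_ne (Finset.sum_nonneg fun i _ => sq_nonneg _) fun h => hx ?_
      have h' := (Finset.sum_eq_zero_iff_of_nonneg fun i _ => sq_nonneg (x (Fin.succ i))).1 h.symm
      funext j
      induction j using Fin.cases with
      | zero => exact h0
      | succ j => simpa using h' j (Finset.mem_univ j)
    have hz : Tendsto (fun k : ℕ => a ^ 2 * N / ((k : ℝ) + 1) ^ 2) atTop (𝓝 0) :=
      ((tendsto_pow_atTop two_ne_zero).comp hlim).const_div_atTop _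
    refine tendsto_const_nhds.congr' ?_
    filter_upwards [hz.eventually_lt_const hpos] with k hk
    symm
    have : hitSet m ((k : ℝ) + 1) (a ^ 2 * N) x = ∅ := by
      refine Set.eq_empty_of_forall_notMem fun u hu => ?_
      have := sum_sq_lt_of_mem_hitSet (by positivity) hu
      simp only [h0, mul_zero, add_zero] at this
      linarith
    rw [this, measure_empty]
  · refine tendsto_of_tendsto_of_tendsto_of_le_of_le tendsto_const_nhds ?_ (fun _ => zero_le)
      fun k : ℕ => volume_hitSet_le (by positivity) ha h0
    have h1 : Tendsto (fun k : ℕ => √Real.pi * a / ((k : ℝ) + 1) * |x 0|⁻¹) atTop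
        (𝓝 (0 * |x 0|⁻¹)) := (hlim.const_div_atTop _).mul_const _
    have h2 := ENNReal.tendsto_ofReal ((h1.pow m).const_mul (Real.exp N))
    simpa [hm] using h2

lemma volume_hitSet_le_coneWeight {m : ℕ} {T a N D : ℝ} (hT : 1 ≤ T) (ha : 0 < a)
    (hD : √(a ^ 2 * N) ≤ D) {x w : Fin (m + 1) → ℝ} (hxw : ∀ i, |w i - x i| ≤ D)
    (hx : ∃ i, 3 * D < |x i|) :
    volume (hitSet m T (a ^ 2 * N) x) ≤
      coneWeight m (Real.exp N * (2 * (√Real.pi * a / T)) ^ m)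
        (2 * (√(a ^ 2 * N) * T ^ m)) w := by
  have hT0 : 0 < T := by linarith
  have hD0 : 0 ≤ D := (Real.sqrt_nonneg _).trans hD
  rcases Set.eq_empty_or_nonempty (hitSet m T (a ^ 2 * N) x) with he | ⟨u, hu⟩
  · simp [he]
  have hs := abs_succ_le_of_mem_hitSet hT hu
  have h0 := abs_zero_le_of_mem_hitSet hT0 hu
  have hx0 : 2 * D < |x 0| := by
    obtain ⟨i, hi⟩ := hx
    induction i using Fin.cases with
    | zero => linarith
    | succ i => linarith [hs i]
  have hw0 := abs_le.1 ((abs_abs_sub_abs_le_abs_sub (w 0) (x 0)).trans (hxw 0))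
  have hmem : w ∈ {w : Fin (m + 1) → ℝ | |w 0| ≤ 2 * (√(a ^ 2 * N) * T ^ m) ∧
      ∀ i : Fin m, |w i.succ| ≤ 4 * |w 0|} := by
    refine ⟨by linarith, fun i => ?_⟩
    have := abs_le.1 ((abs_abs_sub_abs_le_abs_sub (w i.succ) (x i.succ)).trans (hxw i.succ))
    linarith [hs i]
  have hx0' : x 0 ≠ 0 := abs_pos.1 (by linarith)
  refine (volume_hitSet_le hT0 ha hx0').trans ?_
  rw [coneWeight, Set.indicator_of_mem hmem]
  refine ENNReal.ofReal_le_ofReal ?_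
  rw [mul_assoc, ← mul_pow]
  have hwp : 0 < |w 0| := by linarith
  have hxp : 0 < |x 0| := by linarith
  have : |x 0|⁻¹ ≤ 2 * |w 0|⁻¹ := by
    rw [← div_eq_mul_inv, inv_eq_one_div, div_le_div_iff₀ hxp hwp]
    linarith
  refine mul_le_mul_of_nonneg_left (pow_le_pow_left₀ (by positivity) ?_ m) (Real.exp_nonneg _)
  calc √Real.pi * a / T * |x 0|⁻¹ ≤ √Real.pi * a / T * (2 * |w 0|⁻¹) := by gcongr
    _ = _ := by ring

lemma finite_setOf_abs_mulVec_le {n : ℕ} (g : SL n) (M : ℝ) :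
    {v : Fin n → ℤ | ∀ i, |((g : Matrix (Fin n) (Fin n) ℝ) *ᵥ fun j => (v j : ℝ)) i| ≤ M}.Finite := by
  set h : Matrix (Fin n) (Fin n) ℝ := ((g⁻¹ : SL n) : Matrix (Fin n) (Fin n) ℝ) with hh
  set B : ℝ := (∑ i, ∑ j, |h i j|) * M with hB
  refine (Set.finite_Icc (fun _ : Fin n => -⌈B⌉) (fun _ => ⌈B⌉)).subset fun v hv => ?_
  have hinv : h *ᵥ ((g : Matrix (Fin n) (Fin n) ℝ) *ᵥ fun j => (v j : ℝ)) = fun j => (v j : ℝ) := by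
    rw [Matrix.mulVec_mulVec, hh, ← Matrix.SpecialLinearGroup.coe_mul, inv_mul_cancel,
      Matrix.SpecialLinearGroup.coe_one, Matrix.one_mulVec]
  have hv' : ∀ i, |(v i : ℝ)| ≤ B := by
    intro i
    have hM : 0 ≤ M := (abs_nonneg _).trans (hv i)
    rw [← congrFun hinv i]
    change |∑ j, h i j * ((g : Matrix (Fin n) (Fin n) ℝ) *ᵥ fun j => (v j : ℝ)) j| ≤ B
    refine (Finset.abs_sum_le_sum_abs _ _).trans ?_
    calc ∑ j, |h i j * ((g : Matrix (Fin n) (Fin n) ℝ) *ᵥ fun j => (v j : ℝ)) j|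
        ≤ ∑ j, |h i j| * M := by
          refine Finset.sum_le_sum fun j _ => ?_
          rw [abs_mul]
          exact mul_le_mul_of_nonneg_left (hv j) (abs_nonneg _)
      _ = (∑ j, |h i j|) * M := by rw [Finset.sum_mul]
      _ ≤ B := by
          refine mul_le_mul_of_nonneg_right ?_ hM
          exact Finset.single_le_sum (f := fun i => ∑ j, |h i j|)
            (fun i _ => Finset.sum_nonneg fun j _ => abs_nonneg _) (Finset.mem_univ i)
  have hc : ∀ i, -⌈B⌉ ≤ v i ∧ v i ≤ ⌈B⌉ := by
    intro i
    rw [← abs_le]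
    have : ((|v i| : ℤ) : ℝ) ≤ ⌈B⌉ := by
      rw [Int.cast_abs]
      exact (hv' i).trans (Int.le_ceil B)
    exact_mod_cast this
  exact ⟨fun i => (hc i).1, fun i => (hc i).2⟩

lemma mulVec_intCast_ne_zero {n : ℕ} (g : SL n) {v : Fin n → ℤ} (hv : v ≠ 0) :
    ((g : Matrix (Fin n) (Fin n) ℝ) *ᵥ fun j => (v j : ℝ)) ≠ 0 := by
  intro h
  have := Matrix.eq_zero_of_mulVec_eq_zero (by rw [g.det_coe]; exact one_ne_zero) h
  exact hv (funext fun j => by simpa using congrFun this j)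

lemma lintegral_comp_mulVec {n : ℕ} (g : SL n) {f : (Fin n → ℝ) → ℝ≥0∞} (hf : Measurable f) :
    ∫⁻ y, f ((g : Matrix (Fin n) (Fin n) ℝ) *ᵥ y) = ∫⁻ y, f y := by
  have hdet : (g : Matrix (Fin n) (Fin n) ℝ).det = 1 := g.det_coe
  have h := Real.map_matrix_volume_pi_eq_smul_volume_pi
    (M := (g : Matrix (Fin n) (Fin n) ℝ)) (by rw [hdet]; exact one_ne_zero)
  rw [hdet, inv_one, abs_one, ENNReal.ofReal_one, one_smul] at h
  have hm : Measurable (Matrix.toLin' (g : Matrix (Fin n) (Fin n) ℝ)) :=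
    (LinearMap.continuous_of_finiteDimensional _).measurable
  conv_rhs => rw [← h, lintegral_map hf hm]
  simp [Matrix.toLin'_apply]

lemma abs_mulVec_sub_mulVec_floor_le {n : ℕ} (g : Matrix (Fin n) (Fin n) ℝ) (y : Fin n → ℝ)
    (i : Fin n) : |(g *ᵥ y) i - (g *ᵥ fun j => ((⌊y j⌋ : ℤ) : ℝ)) i| ≤ ∑ i, ∑ j, |g i j| := by
  rw [← Pi.sub_apply, ← Matrix.mulVec_sub]
  change |∑ j, g i j * (y - fun j => ((⌊y j⌋ : ℤ) : ℝ)) j| ≤ _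
  refine (Finset.abs_sum_le_sum_abs _ _).trans ?_
  refine le_trans (Finset.sum_le_sum fun j _ => ?_)
    (Finset.single_le_sum (f := fun i => ∑ j, |g i j|)
      (fun i _ => Finset.sum_nonneg fun j _ => abs_nonneg _) (Finset.mem_univ i))
  rw [abs_mul]
  refine mul_le_of_le_one_right (abs_nonneg _) ?_
  simp only [Pi.sub_apply, Int.self_sub_floor, Int.abs_fract]
  exact (Int.fract_lt_one _).le

lemma eventually_volume_exists_mem_hitSet_le {m : ℕ} (hm : m ≠ 0) {a : ℝ} (ha : 0 < a) (N : ℝ)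
    (g : SL (m + 1)) {δ : ℝ≥0∞} (hδ : 0 < δ) :
    ∀ᶠ k : ℕ in atTop,
      volume {u : Fin m → ℝ | ∃ v : Fin (m + 1) → ℤ, v ≠ 0 ∧
        u ∈ hitSet m ((k : ℝ) + 1) (a ^ 2 * N)
          ((g : Matrix (Fin (m + 1)) (Fin (m + 1)) ℝ) *ᵥ fun j => (v j : ℝ))} ≤
      ENNReal.ofReal (Real.exp N * (16 * √Real.pi * a) ^ m * (4 * √(a ^ 2 * N))) + δ := by
  set G : Matrix (Fin (m + 1)) (Fin (m + 1)) ℝ :=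
    (g : Matrix (Fin (m + 1)) (Fin (m + 1)) ℝ) with hG
  set D : ℝ := √(a ^ 2 * N) + ∑ i, ∑ j, |G i j| with hD
  have hsum : 0 ≤ ∑ i, ∑ j, |G i j| :=
    Finset.sum_nonneg fun i _ => Finset.sum_nonneg fun j _ => abs_nonneg _
  have hD1 : √(a ^ 2 * N) ≤ D := by linarith
  have hD2 : ∑ i, ∑ j, |G i j| ≤ D := by linarith [Real.sqrt_nonneg (a ^ 2 * N)]
  have hfin := finite_setOf_abs_mulVec_le g (3 * D)
  set F : Finset (Fin (m + 1) → ℤ) := hfin.toFinset.erase 0 with hF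
  have hF0 : ∀ v ∈ F, v ≠ 0 := fun v hv => Finset.ne_of_mem_erase hv
  have hFn : ∀ v, v ≠ 0 → v ∉ F → ∃ i, 3 * D < |(G *ᵥ fun j => (v j : ℝ)) i| := by
    intro v hv0 hv
    by_contra! hcon
    exact hv (Finset.mem_erase.2 ⟨hv0, hfin.mem_toFinset.2 hcon⟩)
  have hlim : Tendsto (fun k : ℕ => ∑ v ∈ F,
      volume (hitSet m ((k : ℝ) + 1) (a ^ 2 * N) (G *ᵥ fun j => (v j : ℝ)))) atTop (𝓝 0) := by
    rw [← Finset.sum_const_zero (s := F)]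
    exact tendsto_finsetSum _ fun v hv =>
      tendsto_volume_hitSet hm ha (mulVec_intCast_ne_zero g (hF0 v hv))
  filter_upwards [hlim.eventually_lt_const hδ] with k hk
  set T : ℝ := (k : ℝ) + 1 with hT
  have hT1 : 1 ≤ T := by simp [hT]
  have hT0 : T ≠ 0 := by positivity
  set V : (Fin (m + 1) → ℤ) → Set (Fin m → ℝ) := fun v =>
    hitSet m T (a ^ 2 * N) (G *ᵥ fun j => (v j : ℝ)) with hV
  set b : (Fin (m + 1) → ℤ) → ℝ≥0∞ := fun v =>
    Set.indicator {v | v ≠ 0 ∧ v ∉ F} (fun v => volume (V v)) v with hb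
  set W := coneWeight m (Real.exp N * (2 * (√Real.pi * a / T)) ^ m)
    (2 * (√(a ^ 2 * N) * T ^ m)) with hW
  have htail : ∑' v, b v ≤
      ENNReal.ofReal (Real.exp N * (16 * √Real.pi * a) ^ m * (4 * √(a ^ 2 * N))) := by
    calc ∑' v, b v ≤ ∫⁻ y, W (G *ᵥ y) := by
          refine tsum_le_lintegral_floor b _ fun y => ?_
          by_cases hv : (fun i => ⌊y i⌋) ∈ {v | v ≠ 0 ∧ v ∉ F}
          swap
          · simp only [hb, Set.indicator_of_notMem hv, zero_le]
          simp only [hb, Set.indicator_of_mem hv]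
          exact volume_hitSet_le_coneWeight hT1 ha hD1
            (fun i => (abs_mulVec_sub_mulVec_floor_le G y i).trans hD2) (hFn _ hv.1 hv.2)
      _ = ∫⁻ y, W y := lintegral_comp_mulVec g (measurable_coneWeight _ _ _)
      _ ≤ _ := lintegral_coneWeight_le m _ (by positivity)
      _ = _ := by
          congr 1
          have : (16 * √Real.pi * a) ^ m = (2 * (√Real.pi * a / T)) ^ m * 8 ^ m * T ^ m := by
            rw [← mul_pow, ← mul_pow]
            congr 1
            field_simp
            norm_num
          rw [this]
          ring
  have hsub : {u : Fin m → ℝ | ∃ v : Fin (m + 1) → ℤ, v ≠ 0 ∧ u ∈ V v} ⊆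
      (⋃ v ∈ F, V v) ∪ ⋃ v : {v | v ≠ 0 ∧ v ∉ F}, V v := by
    rintro u ⟨v, hv0, hu⟩
    by_cases hv : v ∈ F
    · exact Or.inl (Set.mem_biUnion hv hu)
    · exact Or.inr (Set.mem_iUnion.2 ⟨⟨v, hv0, hv⟩, hu⟩)
  calc volume {u : Fin m → ℝ | ∃ v : Fin (m + 1) → ℤ, v ≠ 0 ∧ u ∈ V v}
      ≤ volume (⋃ v ∈ F, V v) + volume (⋃ v : {v | v ≠ 0 ∧ v ∉ F}, V v) :=
        (measure_mono hsub).trans (measure_union_le _ _)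
    _ ≤ ∑ v ∈ F, volume (V v) + ∑' v : {v | v ≠ 0 ∧ v ∉ F}, volume (V v) :=
        add_le_add (measure_biUnion_finset_le _ _) (measure_iUnion_le _)
    _ = ∑ v ∈ F, volume (V v) + ∑' v, b v := by
        rw [tsum_subtype {v | v ≠ 0 ∧ v ∉ F} fun v => volume (V v)]
    _ ≤ δ + _ := add_le_add hk.le htail
    _ = _ := add_comm _ _

instance (n : ℕ) : IsTopologicalGroup (SL n) :=
  Matrix.SpecialLinearGroup.topologicalGroup

instance (n : ℕ) : BorelSpace (SL n ⧸ SLZ n) := ⟨rfl⟩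

/-- The classes of lattices having a nonzero vector of squared norm less than `r`. -/
def shortSet (n : ℕ) (r : ℝ) : Set (SL n ⧸ SLZ n) :=
  {q | ∃ g : SL n, (g : SL n ⧸ SLZ n) = q ∧ ∃ v : Fin n → ℤ, v ≠ 0 ∧
    ∑ j, ((g : Matrix (Fin n) (Fin n) ℝ) *ᵥ fun j => (v j : ℝ)) j ^ 2 < r}

lemma mk_mem_shortSet {n : ℕ} {r : ℝ} (g : SL n) :
    (g : SL n ⧸ SLZ n) ∈ shortSet n r ↔ ∃ v : Fin n → ℤ, v ≠ 0 ∧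
      ∑ j, ((g : Matrix (Fin n) (Fin n) ℝ) *ᵥ fun j => (v j : ℝ)) j ^ 2 < r := by
  refine ⟨?_, fun h => ⟨g, rfl, h⟩⟩
  rintro ⟨g', hg', v, hv, h⟩
  obtain ⟨γ, hγ⟩ := QuotientGroup.eq.1 hg'.symm
  have hmul : g' = g * Matrix.SpecialLinearGroup.map (Int.castRingHom ℝ) γ := by
    rw [hγ, mul_inv_cancel_left]
  have hcast : (fun j => (((γ : Matrix (Fin n) (Fin n) ℤ) *ᵥ v) j : ℝ)) =
      (γ : Matrix (Fin n) (Fin n) ℤ).map (Int.castRingHom ℝ) *ᵥ fun j => (v j : ℝ) := by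
    funext j
    simp [Matrix.mulVec, dotProduct]
  refine ⟨(γ : Matrix (Fin n) (Fin n) ℤ) *ᵥ v, fun h0 => hv ?_, ?_⟩
  · exact Matrix.eq_zero_of_mulVec_eq_zero (by rw [γ.det_coe]; exact one_ne_zero) h0
  · rw [hcast, Matrix.mulVec_mulVec]
    rw [hmul] at h
    exact h

lemma isOpen_shortSet (n : ℕ) (r : ℝ) : IsOpen (shortSet n r) := by
  rw [← QuotientGroup.isOpenQuotientMap_mk.isQuotientMap.isOpen_preimage]
  have : (QuotientGroup.mk : SL n → SL n ⧸ SLZ n) ⁻¹' shortSet n r =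
      ⋃ v : {v : Fin n → ℤ // v ≠ 0}, {g : SL n |
        ∑ j, ((g : Matrix (Fin n) (Fin n) ℝ) *ᵥ fun j => (v.1 j : ℝ)) j ^ 2 < r} := by
    ext g
    simp [mk_mem_shortSet]
  rw [this]
  have hc : Continuous fun g : SL n => (g : Matrix (Fin n) (Fin n) ℝ) := continuous_induced_dom
  refine isOpen_iUnion fun v => isOpen_lt ?_ continuous_const
  refine continuous_finsetSum _ fun j _ => Continuous.pow ?_ 2
  exact (continuous_apply j).comp (hc.matrix_mulVec continuous_const)

/-- `shear m T u` as an element of the special linear group. -/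
def shearSL (m : ℕ) {T : ℝ} (hT : T ≠ 0) (u : Fin m → ℝ) : SL (m + 1) :=
  ⟨shear m T u, det_shear m hT u⟩

lemma continuous_shearSL (m : ℕ) {T : ℝ} (hT : T ≠ 0) : Continuous (shearSL m hT) := by
  refine continuous_induced_rng.2 (continuous_matrix fun i j => ?_)
  change Continuous fun u => shear m T u i j
  induction i using Fin.cases with
  | zero => simpa [shear] using continuous_const
  | succ i =>
    induction j using Fin.cases with
    | zero =>
      simp only [shear, Matrix.of_apply, Fin.cons_succ, Fin.cons_zero]
      fun_prop
    | succ j => simpa [shear] using continuous_const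

lemma measure_shortSet_le {m : ℕ} (hm : m ≠ 0) {a : ℝ} (ha : 0 < a) (N : ℝ)
    (ν : Measure (SL (m + 1) ⧸ SLZ (m + 1))) [IsProbabilityMeasure ν]
    (hν : ∀ g : SL (m + 1), Measure.map (fun x => g • x) ν = ν) :
    ν (shortSet (m + 1) (a ^ 2 * N)) ≤
      ENNReal.ofReal (Real.exp N * (16 * √Real.pi * a) ^ m * (4 * √(a ^ 2 * N))) := by
  set A := ENNReal.ofReal (Real.exp N * (16 * √Real.pi * a) ^ m * (4 * √(a ^ 2 * N))) with hA
  refine ENNReal.le_of_forall_pos_le_add fun δ hδ _ => ?_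
  set μ : Measure (Fin m → ℝ) := volume.restrict (Set.Icc 0 1) with hμ
  have hμ1 : IsProbabilityMeasure μ := ⟨by simp [hμ, Real.volume_Icc_pi]⟩
  set E := shortSet (m + 1) (a ^ 2 * N) with hE
  have hEo : IsOpen E := isOpen_shortSet _ _
  have hT : ∀ k : ℕ, (k : ℝ) + 1 ≠ 0 := fun k => by positivity
  set P : ℕ → Set ((Fin m → ℝ) × (SL (m + 1) ⧸ SLZ (m + 1))) := fun k =>
    {p | shearSL m (hT k) p.1 • p.2 ∈ E} with hP
  have hPm : ∀ k, MeasurableSet (P k) := fun k =>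
    (hEo.preimage (((continuous_shearSL m (hT k)).comp continuous_fst).smul
      continuous_snd)).measurableSet
  have hint : ∀ k, ∫⁻ q, μ ((fun u => (u, q)) ⁻¹' P k) ∂ν = ν E := by
    intro k
    rw [← Measure.prod_apply_symm (hPm k), Measure.prod_apply (hPm k)]
    have : ∀ u, ν (Prod.mk u ⁻¹' P k) = ν E := by
      intro u
      conv_rhs => rw [← hν (shearSL m (hT k) u)]
      rw [Measure.map_apply (measurable_const_smul _) hEo.measurableSet]
      rfl
    simp [this]
  have hev : ∀ q, ∀ᶠ k in atTop, μ ((fun u => (u, q)) ⁻¹' P k) ≤ A + δ := by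
    intro q
    obtain ⟨g, rfl⟩ := QuotientGroup.mk_surjective q
    filter_upwards [eventually_volume_exists_mem_hitSet_le hm ha N g
      (ENNReal.coe_pos.2 hδ)] with k hk
    refine le_trans ?_ hk
    rw [hμ, Measure.restrict_apply (measurable_prodMk_right (hPm k))]
    refine measure_mono ?_
    rintro u ⟨hu, hu1⟩
    have hu : ((shearSL m (hT k) u * g : SL (m + 1)) : SL (m + 1) ⧸ SLZ (m + 1)) ∈ E := hu
    obtain ⟨v, hv, h⟩ := (mk_mem_shortSet _).1 hu
    refine ⟨v, hv, hu1, ?_⟩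
    rw [Matrix.mulVec_mulVec]
    exact h
  have hdom := tendsto_lintegral_of_dominated_convergence (μ := ν)
    (F := fun k q => μ ((fun u => (u, q)) ⁻¹' P k) ⊔ (A + δ)) (f := fun _ => A + δ)
    (fun _ => 1 ⊔ (A + δ))
    (fun k => (measurable_measure_prodMk_right (hPm k)).sup_const _)
    (fun k => Eventually.of_forall fun q => sup_le_sup_right prob_le_one _)
    (by simp [hA])
    (Eventually.of_forall fun q => tendsto_const_nhds.congr' <| by
      filter_upwards [hev q] with k hk
      exact (sup_eq_right.2 hk).symm)
  rw [lintegral_const, measure_univ, mul_one] at hdom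
  refine ge_of_tendsto' hdom fun k => ?_
  rw [← hint k]
  exact lintegral_mono fun q => le_sup_left

lemma exp_mul_pow_mul_sqrt_le {a : ℝ} (ha : 0 < a)
    (h1 : 16 * √Real.pi * a * Real.exp 1 * 4 ≤ 1) (h2 : a * Real.exp 1 * 8 ≤ 1) (m : ℕ) :
    Real.exp (m + 1 : ℕ) * (16 * √Real.pi * a) ^ m * (4 * √(a ^ 2 * (m + 1 : ℕ))) ≤
      (2 : ℝ) ^ (-(1 * ((m + 1 : ℕ) : ℝ))) := by
  have hs : √(a ^ 2 * (m + 1 : ℕ)) ≤ a * 2 ^ m := by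
    rw [Real.sqrt_mul (by positivity), Real.sqrt_sq ha.le]
    gcongr
    rw [Real.sqrt_le_left (by positivity)]
    have hlt : ((m + 1 : ℕ) : ℝ) ≤ 2 ^ m := by exact_mod_cast Nat.lt_two_pow_self
    refine hlt.trans ?_
    have : (1 : ℝ) ≤ 2 ^ m := one_le_pow₀ (by norm_num)
    nlinarith
  have he : Real.exp (m + 1 : ℕ) = Real.exp 1 * Real.exp 1 ^ m := by
    rw [← Real.exp_one_pow, pow_succ']
  have hr : (2 : ℝ) ^ (-(1 * ((m + 1 : ℕ) : ℝ))) = (1 / 2) * (1 / 2) ^ m := by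
    rw [one_mul, Real.rpow_neg (by norm_num), Real.rpow_natCast, pow_succ', one_div, mul_inv,
      inv_pow]
  rw [hr, he]
  calc Real.exp 1 * Real.exp 1 ^ m * (16 * √Real.pi * a) ^ m * (4 * √(a ^ 2 * (m + 1 : ℕ)))
      ≤ Real.exp 1 * Real.exp 1 ^ m * (16 * √Real.pi * a) ^ m * (4 * (a * 2 ^ m)) := by gcongr
    _ = (a * Real.exp 1 * 4) * (16 * √Real.pi * a * Real.exp 1 * 2) ^ m := by
        simp only [mul_pow]
        ring
    _ ≤ (1 / 2) * (1 / 2) ^ m := by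
        gcongr <;> linarith

/-- There exist `c > 0`, `ε > 0` and `n₀` such that for every
`n ≥ n₀` and every `SL_n(ℝ)`-invariant Borel probability measure `ν` on
`SL_n(ℝ)/SL_n(ℤ)`, the measure of the set of lattices `g·ℤⁿ` containing a
nonzero vector of norm at most `c·√n` is at most `2^(−εn)`. -/
theorem random_lattice_first_minimum_large :
    ∃ c > (0 : ℝ), ∃ ε > (0 : ℝ), ∃ n₀ : ℕ, ∀ n : ℕ, n₀ ≤ n →
      ∀ ν : Measure (SL n ⧸ SLZ n), IsProbabilityMeasure ν →
        (∀ g : SL n, Measure.map (fun x => g • x) ν = ν) →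
        ν {q : SL n ⧸ SLZ n | ∃ g : SL n, (g : SL n ⧸ SLZ n) = q ∧
            ∃ x ∈ latticeOf g, x ≠ 0 ∧ ‖x‖ ≤ c * Real.sqrt n}
          ≤ ENNReal.ofReal ((2 : ℝ) ^ (-(ε * n))) := by
  set a : ℝ := (64 * (√Real.pi + 1) * Real.exp 1)⁻¹ with ha_def
  have ha : 0 < a := by positivity
  have he : 0 < Real.exp 1 := Real.exp_pos 1
  have hp : 0 ≤ √Real.pi := Real.sqrt_nonneg _
  have hinv : a * (64 * (√Real.pi + 1) * Real.exp 1) = 1 := inv_mul_cancel₀ (by positivity)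
  have hae : 0 < a * Real.exp 1 := by positivity
  refine ⟨a / 2, by positivity, 1, one_pos, 2, fun n hn ν hν hinvt => ?_⟩
  obtain ⟨m, rfl⟩ : ∃ m, n = m + 1 := ⟨n - 1, by omega⟩
  refine (measure_mono ?_).trans ((measure_shortSet_le (by omega) ha ((m + 1 : ℕ) : ℝ) ν
    hinvt).trans (ENNReal.ofReal_le_ofReal (exp_mul_pow_mul_sqrt_le ha ?_ ?_ m)))
  · rintro q ⟨g, hg, x, ⟨v, rfl⟩, hx, hnorm⟩
    refine ⟨g, hg, v, fun hv => hx ?_, ?_⟩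
    · subst hv
      ext i
      simp [Matrix.mulVec, dotProduct]
    · rw [EuclideanSpace.norm_eq] at hnorm
      have h := (Real.sqrt_le_left (by positivity)).1 hnorm
      rw [mul_pow, Real.sq_sqrt (by positivity)] at h
      simp only [Real.norm_eq_abs, sq_abs] at h
      refine lt_of_le_of_lt h ?_
      gcongr
      linarith
  · nlinarith
  · nlinarith [mul_nonneg hae.le hp]

end
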